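/- arXiv:2103.09018 — 2 statements merged into one kernel-verified Lean document; each statement's English description precedes it below -/
import Mathlib

section
/- Let α ∈ (0,1) be irrational, T the rotation of angle α viewed as a 2-interval exchange transformation on [0,1) with discontinuity 1 − α, N ≥ 2 an integer, and T_f the Veech 1969 type extension of T with single marked point ζ₁ and integers a₁, a₂. If ζ₁ = mα for an integer m ≥ 1 with 0 < mα < 1, then T_f is minimal if and only if gcd(N, m·a₁, a₂) = 1. -/
open Set

noncomputable section

/-- The rotation of angle `α` on `[0,1)`: `x ↦ x + α mod 1`. -/
def rot (α : ℝ) (x : ℝ) : ℝ := Int.fract (x + α)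

/-- The skew product `T_f(x,s) = (Tx, s + f(x))` on `[0,1) × ℤ/Nℤ`. -/
def skew {N : ℕ} (T : ℝ → ℝ) (f : ℝ → ZMod N) : ℝ × ZMod N → ℝ × ZMod N :=
  fun p => (T p.1, p.2 + f p.1)

/-- Minimality of the skew product on `[0,1) × ℤ/Nℤ`, where `[0,1)` carries the topology of
the circle `ℝ/ℤ` (distances being measured in `AddCircle 1`) and `ℤ/Nℤ` is discrete:
every forward orbit is dense. -/
def MinimalExt {N : ℕ} (T : ℝ → ℝ) (f : ℝ → ZMod N) : Prop :=
  ∀ x ∈ Ico (0:ℝ) 1, ∀ s : ZMod N, ∀ y ∈ Ico (0:ℝ) 1, ∀ u : ZMod N, ∀ ε > 0, ∃ n : ℕ,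
    dist (((skew T f)^[n] (x, s)).1 : AddCircle (1:ℝ)) (y : AddCircle (1:ℝ)) < ε ∧
    ((skew T f)^[n] (x, s)).2 = u


/-- The two-valued step function: `a₁` on `[0,ζ)` and `a₂` on `[ζ,1)` (values in `ℤ/Nℤ`). -/
def twoval (N : ℕ) (ζ : ℝ) (a₁ a₂ : ℤ) (x : ℝ) : ZMod N :=
  if x < ζ then (a₁ : ZMod N) else (a₂ : ZMod N)

/-- The sum of `⌊t - l * α⌋` over `1 ≤ l ≤ M`. -/
def floorSum (M : ℕ) (α t : ℝ) : ℤ := ∑ l ∈ Finset.range M, ⌊t - (l + 1) * α⌋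

lemma floorSum_add_int (M : ℕ) (α t : ℝ) (z : ℤ) :
    floorSum M α (t + z) = floorSum M α t + M * z := by
  have h (l : ℕ) : ⌊t + z - (l + 1) * α⌋ = ⌊t - (l + 1) * α⌋ + z := by
    rw [← Int.floor_add_intCast]
    congr 1
    ring
  simp [floorSum, h, Finset.sum_add_distrib]

lemma floorSum_add_self (M : ℕ) (α t : ℝ) :
    floorSum M α (t + α) - floorSum M α t = ⌊t⌋ - ⌊t - M * α⌋ := by
  induction M with
  | zero => simp [floorSum]
  | succ M ih =>
    simp only [floorSum, Finset.sum_range_succ] at ih ⊢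
    have h : t + α - (M + 1) * α = t - M * α := by ring
    rw [h]
    push_cast
    linarith

lemma floorSum_right_const (M : ℕ) (α t : ℝ) :
    ∃ δ > 0, ∀ t', t ≤ t' → t' < t + δ → floorSum M α t' = floorSum M α t := by
  induction M with
  | zero => exact ⟨1, one_pos, fun _ _ _ => rfl⟩
  | succ M ih =>
    obtain ⟨δ, hδ, h⟩ := ih
    refine ⟨min δ (1 - Int.fract (t - (M + 1) * α)),
      lt_min hδ (sub_pos.2 (Int.fract_lt_one _)), fun t' h₁ h₂ => ?_⟩
    have hl := min_le_left δ (1 - Int.fract (t - (M + 1) * α))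
    have hr := min_le_right δ (1 - Int.fract (t - (M + 1) * α))
    have hs := h t' h₁ (by linarith)
    simp only [floorSum, Finset.sum_range_succ] at hs ⊢
    rw [hs, add_right_inj, Int.floor_eq_iff]
    have := Int.floor_add_fract (t - (M + 1) * α)
    have := Int.fract_nonneg (t - (M + 1) * α)
    constructor <;> linarith

/-- The value of the step function at a fractional part is a coboundary of `floorSum`. -/
lemma twoval_fract (N M : ℕ) (α : ℝ) (a₁ a₂ : ℤ) (hM : (M : ℝ) * α ∈ Ioo (0 : ℝ) 1) (t : ℝ) :
    twoval N (M * α) a₁ a₂ (Int.fract t) =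
      ((a₂ + (a₁ - a₂) * (floorSum M α (t + α) - floorSum M α t) : ℤ) : ZMod N) := by
  have h₀ := Int.fract_nonneg t
  have h₁ := Int.fract_lt_one t
  have h := Int.floor_add_fract t
  obtain ⟨hM₀, hM₁⟩ := hM
  rw [floorSum_add_self, twoval]
  split_ifs with hlt
  · have : ⌊t - M * α⌋ = ⌊t⌋ - 1 := by
      rw [Int.floor_eq_iff]
      push_cast
      constructor <;> linarith
    rw [this]
    congr 1
    ring
  · have : ⌊t - M * α⌋ = ⌊t⌋ := by
      rw [Int.floor_eq_iff]
      constructor <;> linarith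
    rw [this]
    congr 1
    ring

lemma skew_iterate (N M : ℕ) (α : ℝ) (a₁ a₂ : ℤ) (hM : (M : ℝ) * α ∈ Ioo (0 : ℝ) 1)
    {x : ℝ} (hx : x ∈ Ico (0 : ℝ) 1) (s : ZMod N) (n : ℕ) :
    (skew (rot α) (twoval N (M * α) a₁ a₂))^[n] (x, s) =
      (Int.fract (x + n * α),
        s + ((n * a₂ + (a₁ - a₂) * (floorSum M α (x + n * α) - floorSum M α x) : ℤ) : ZMod N)) := by
  induction n with
  | zero => simp [Int.fract_eq_self.2 hx]
  | succ n ih =>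
    have hn : x + (n + 1 : ℕ) * α = x + n * α + α := by push_cast; ring
    rw [Function.iterate_succ_apply', ih, skew, twoval_fract N M α a₁ a₂ hM, hn]
    refine Prod.ext ?_ ?_
    · simp only [rot]
      rw [Int.fract_eq_fract]
      refine ⟨-⌊x + n * α⌋, ?_⟩
      rw [Int.fract]
      push_cast
      ring
    · push_cast
      ring

lemma exists_nat_mul_add_int_mem_Ioo {α : ℝ} (hirr : Irrational α) (c : ℝ) {δ : ℝ} (hδ : 0 < δ) :
    ∃ (k : ℕ) (q : ℤ), k * α + q ∈ Ioo c (c + δ) := by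
  have hd : DenseRange (fun k : ℕ => k • (α : AddCircle (1 : ℝ))) := by
    rw [← denseRange_zsmul_iff_nsmul]
    exact AddCircle.denseRange_zsmul_coe_iff.2 (by simpa using hirr)
  obtain ⟨k, hk⟩ := hd.exists_dist_lt ((c + δ / 2 : ℝ) : AddCircle (1 : ℝ)) (half_pos hδ)
  rw [← AddCircle.coe_nsmul, dist_eq_norm, ← AddCircle.coe_sub, UnitAddCircle.norm_eq,
    abs_lt, nsmul_eq_mul] at hk
  exact ⟨k, round (c + δ / 2 - k * α), by constructor <;> linarith⟩

/-- Bézout coefficients for the fibre coordinate. -/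
lemma exists_eq_mul_add_mul_of_isUnit {N : ℕ} {m a₁ a₂ : ℤ}
    (h : ∀ k : ℤ, k ∣ (N : ℤ) → k ∣ m * a₁ → k ∣ a₂ → IsUnit k) (w : ZMod N) :
    ∃ i j : ℤ, w = ((i * a₂ + (a₁ - a₂) * (m * j) : ℤ) : ZMod N) := by
  have hu := h (gcd (N : ℤ) (gcd (m * a₁) a₂)) (gcd_dvd_left _ _)
    ((gcd_dvd_right _ _).trans (gcd_dvd_left _ _)) ((gcd_dvd_right _ _).trans (gcd_dvd_right _ _))
  obtain ⟨a, b, hab⟩ := (gcd_isUnit_iff _ _).1 hu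
  obtain ⟨c, d, hcd⟩ := exists_gcd_eq_mul_add_mul (m * a₁) a₂
  obtain ⟨w, rfl⟩ := ZMod.intCast_surjective w
  refine ⟨w * (b * d + b * c * m), w * (b * c), ?_⟩
  rw [ZMod.intCast_eq_intCast_iff_dvd_sub]
  refine ⟨-(w * a), ?_⟩
  rw [hcd] at hab
  linear_combination w * hab

/-- If `ζ₁ = mα` with `m ≥ 1` and `0 < mα < 1`, the extension `T_f` of the rotation by `α` is minimal iff `gcd(N, m·a₁, a₂) = 1`. -/
theorem twoval_minimal_iff_of_eq_mul_alpha
    (α : ℝ) (hα : α ∈ Ioo (0:ℝ) 1) (hirr : Irrational α) (N : ℕ) (hN : 2 ≤ N)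
    (m : ℤ) (hm : 1 ≤ m) (a₁ a₂ : ℤ) (ζ : ℝ) (hζ : ζ = (m : ℝ) * α)
    (hζmem : ζ ∈ Ioo (0:ℝ) 1)  :
    MinimalExt (rot α) (twoval N ζ a₁ a₂) ↔
      ∀ k : ℤ, k ∣ (N : ℤ) → k ∣ m * a₁ → k ∣ a₂ → IsUnit k := by
  obtain ⟨M, rfl⟩ : ∃ M : ℕ, m = M := ⟨m.toNat, by omega⟩
  subst hζ
  rw [Int.cast_natCast] at hζmem ⊢
  have : NeZero N := ⟨by omega⟩
  constructor
  · intro hmin k hkN hk₁ hk₂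
    obtain ⟨δ, hδ, hconst⟩ := floorSum_right_const M α 0
    have hδ' : 0 < min δ 1 := lt_min hδ one_pos
    have hle := min_le_left δ 1
    obtain ⟨n, hn, hval⟩ := hmin 0 ⟨le_rfl, one_pos⟩ 0 (min δ 1 / 2)
      ⟨by positivity, by linarith [min_le_right δ 1]⟩ 1 (min δ 1 / 2) (by positivity)
    rw [skew_iterate N M α a₁ a₂ hζmem ⟨le_rfl, one_pos⟩] at hn hval
    simp only [zero_add] at hn hval
    rw [dist_eq_norm, ← AddCircle.coe_sub, UnitAddCircle.norm_eq, abs_lt] at hn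
    set r := round (Int.fract (n * α) - min δ 1 / 2)
    have ht : (n : ℝ) * α = Int.fract (n * α) - r + (⌊n * α⌋ + r : ℤ) := by
      rw [Int.fract]
      push_cast
      ring
    have hf : floorSum M α (n * α) = floorSum M α 0 + M * (⌊n * α⌋ + r) := by
      rw [← hconst (Int.fract (n * α) - r) (by linarith) (by linarith), ← floorSum_add_int, ← ht]
    have hone : ((1 : ℤ) : ZMod N) =
        ((n * a₂ + (a₁ - a₂) * (floorSum M α (n * α) - floorSum M α 0) : ℤ) : ZMod N) := by
      rw [hval, Int.cast_one]
    rw [ZMod.intCast_eq_intCast_iff_dvd_sub, hf] at hone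
    have hdvd := hkN.trans hone
    rw [isUnit_iff_dvd_one]
    refine (dvd_sub_right (a := k) (b := n * a₂ +
      (a₁ - a₂) * (floorSum M α 0 + M * (⌊n * α⌋ + r) - floorSum M α 0)) ?_).1 hdvd
    obtain ⟨b, hb⟩ := hk₁
    obtain ⟨c, hc⟩ := hk₂
    refine ⟨n * c + (b - M * c) * (⌊n * α⌋ + r), ?_⟩
    linear_combination (n - M * (⌊n * α⌋ + r)) * hc + (⌊n * α⌋ + r) * hb
  · intro h x hx s y hy u ε hε
    have hN : (0 : ℝ) < N := Nat.cast_pos.2 (by omega)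
    obtain ⟨δ, hδ, hconst⟩ := floorSum_right_const M α y
    obtain ⟨i, j, hij⟩ := exists_eq_mul_add_mul_of_isUnit h
      (u - s - (((a₁ - a₂) * (floorSum M α y - floorSum M α x) : ℤ) : ZMod N))
    have hi : ((i : ZMod N).val : ZMod N) = i := by simp
    generalize (i : ZMod N).val = p at hi
    have hδε : 0 < min δ ε / N := div_pos (lt_min hδ hε) hN
    obtain ⟨k, q, hlo, hhi⟩ :=
      exists_nat_mul_add_int_mem_Ioo hirr ((y + j - x - p * α) / N) hδε
    rw [div_lt_iff₀ hN] at hlo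
    rw [← add_div, lt_div_iff₀ hN] at hhi
    have hl := min_le_left δ ε
    have hr := min_le_right δ ε
    obtain ⟨d, hd⟩ : ∃ d : ℝ, x + (p + N * k : ℕ) * α = y + d + (j - N * q : ℤ) :=
      ⟨x + (p + N * k : ℕ) * α - (j - N * q : ℤ) - y, by ring⟩
    have hd' := hd
    push_cast at hd'
    have hd₀ : 0 < d := by linarith
    have hd₁ : d < min δ ε := by linarith
    refine ⟨p + N * k, ?_⟩
    rw [skew_iterate N M α a₁ a₂ hζmem hx, hd, Int.fract_add_intCast, floorSum_add_int,
      hconst _ (by linarith) (by linarith)]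
    constructor
    · rw [dist_eq_norm, ← AddCircle.coe_sub, UnitAddCircle.norm_eq]
      refine (round_le _ (-⌊y + d⌋)).trans_lt ?_
      rw [Int.fract, abs_lt]
      push_cast
      constructor <;> linarith
    · push_cast at hij ⊢
      rw [← hi] at hij
      simp only [CharP.cast_eq_zero, zero_mul, add_zero, sub_zero]
      linear_combination -hij
end
end

section
/- Let α ∈ (0,1) be irrational, T the rotation of angle α viewed as a 2-interval exchange transformation on [0,1) with discontinuity 1 − α, N ≥ 2 an integer, and T_f the Veech 1969 type extension of T with single marked point ζ₁ and integers a₁, a₂. If ζ₁ = mα − 1 for an integer m ≥ 2 with 0 < mα − 1 < 1 and α < 1/(m−1), then T_f is minimal if and only if gcd(N, a₁ + (m−2)·a₂, m·a₂) = 1. -/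
open Set

noncomputable section

/-- `stepSum α m t = ∑_{j=1}^{m} ⌊t - jα⌋`, whose increments along the rotation by `α` record the
visits to an interval with endpoints `0` and `mα`. -/
def stepSum (α : ℝ) (m : ℕ) (t : ℝ) : ℤ := ∑ j ∈ Finset.range m, ⌊t - (j + 1 : ℕ) * α⌋

lemma stepSum_add_intCast (α : ℝ) (m : ℕ) (t : ℝ) (k : ℤ) :
    stepSum α m (t + k) = stepSum α m t + m * k := by
  have h (j : ℕ) : ⌊t + k - (j + 1 : ℕ) * α⌋ = ⌊t - (j + 1 : ℕ) * α⌋ + k := by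
    rw [← Int.floor_add_intCast]
    ring_nf
  simp only [stepSum, h, Finset.sum_add_distrib]
  simp

lemma stepSum_add_self (α : ℝ) (m : ℕ) (t : ℝ) :
    stepSum α m (t + α) = stepSum α m t + ⌊t⌋ - ⌊t - m * α⌋ := by
  have h (j : ℕ) : ⌊t + α - (j + 1 : ℕ) * α⌋ = ⌊t - j * α⌋ := by
    push_cast
    ring_nf
  have h₁ := Finset.sum_range_succ (fun j : ℕ => ⌊t - j * α⌋) m
  rw [Finset.sum_range_succ'] at h₁
  simp only [Nat.cast_zero, zero_mul, sub_zero] at h₁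
  simp only [stepSum, h]
  linarith

open Filter Topology in
lemma exists_stepSum_eq_right (α : ℝ) (m : ℕ) (t : ℝ) :
    ∃ δ > 0, ∀ z, t ≤ z → z < t + δ → stepSum α m z = stepSum α m t := by
  have h : ∀ᶠ z in 𝓝[≥] t, ∀ j ∈ Finset.range m,
      ⌊z - (j + 1 : ℕ) * α⌋ = ⌊t - (j + 1 : ℕ) * α⌋ := by
    rw [Filter.eventually_all_finset]
    intro j _
    have h₁ : Tendsto (fun z : ℝ => z - (j + 1 : ℕ) * α) (𝓝[≥] t)
        (𝓝[≥] (t - (j + 1 : ℕ) * α)) := by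
      refine tendsto_nhdsWithin_iff.2 ⟨?_, ?_⟩
      · exact ((continuous_id.sub continuous_const).tendsto t).mono_left inf_le_left
      · filter_upwards [self_mem_nhdsWithin] with z hz
        exact sub_le_sub_right (mem_Ici.1 hz) _
    exact tendsto_pure.1 ((tendsto_floor_right_pure_floor _).comp h₁)
  obtain ⟨u, hu, hsub⟩ := mem_nhdsGE_iff_exists_Ico_subset.1 h
  refine ⟨u - t, sub_pos.2 hu, fun z hz hz' => Finset.sum_congr rfl (hsub ⟨hz, by linarith⟩)⟩

/-- The fibre coordinate of the skew product over a rotation is an affine function of the time and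
of the increment of `stepSum`. -/
lemma skew_rot_twoval_iterate {α ζ : ℝ} {m : ℕ} (hζ : ζ = m * α - 1) (hζmem : ζ ∈ Ioo (0:ℝ) 1)
    (N : ℕ) (a₁ a₂ : ℤ) {x : ℝ} (hx : x ∈ Ico (0:ℝ) 1) (s : ZMod N) (n : ℕ) :
    (skew (rot α) (twoval N ζ a₁ a₂))^[n] (x, s) =
      (Int.fract (x + n * α), s + ((n * (2 * a₂ - a₁) +
        (a₁ - a₂) * (stepSum α m (x + n * α) - stepSum α m x) : ℤ) : ZMod N)) := by
  induction n with
  | zero => simp [Int.fract_eq_self.2 hx]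
  | succ n ih =>
    rw [Function.iterate_succ_apply', ih]
    set t := x + n * α with ht
    have ht' : x + (n + 1 : ℕ) * α = t + α := by rw [ht]; push_cast; ring
    rw [ht']
    refine Prod.ext ?_ ?_
    · change Int.fract (Int.fract t + α) = Int.fract (t + α)
      rw [Int.fract_eq_fract]
      exact ⟨-⌊t⌋, by rw [← Int.self_sub_floor]; push_cast; ring⟩
    · change _ + twoval N ζ a₁ a₂ (Int.fract t) = _
      rw [stepSum_add_self, twoval]
      have h₀ := Int.fract_nonneg t
      have h₁ := Int.fract_lt_one t
      have hf := Int.floor_add_fract t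
      obtain ⟨hζ₀, hζ₁⟩ := hζmem
      split_ifs with h
      · have : ⌊t - m * α⌋ = ⌊t⌋ - 2 := by
          rw [Int.floor_eq_iff]
          push_cast
          constructor <;> linarith
        rw [this]
        push_cast
        ring
      · have : ⌊t - m * α⌋ = ⌊t⌋ - 1 := by
          rw [Int.floor_eq_iff]
          push_cast
          constructor <;> linarith
        rw [this]
        push_cast
        ring

lemma Irrational.exists_nat_mul_sub_int_mem_Ioo {α : ℝ} (hα : Irrational α) {a b : ℝ}
    (hab : a < b) : ∃ (n : ℕ) (k : ℤ), n * α - k ∈ Ioo a b := by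
  have hd : DenseRange (· • (α : AddCircle (1:ℝ)) : ℕ → AddCircle (1:ℝ)) :=
    denseRange_zsmul_iff_nsmul.1 (AddCircle.denseRange_zsmul_coe_iff.2 (by simpa using hα))
  obtain ⟨n, z, hz, hzn⟩ := hd.exists_mem_open
    (QuotientAddGroup.isOpenMap_coe (N := AddSubgroup.zmultiples (1:ℝ)) _ isOpen_Ioo)
    ((nonempty_Ioo.2 hab).image _)
  have h : ((n * α : ℝ) : AddCircle (1:ℝ)) = z := by
    rw [← nsmul_eq_mul, AddCircle.coe_nsmul]
    exact hzn.symm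
  rw [← sub_eq_zero, ← AddCircle.coe_sub, AddCircle.coe_eq_zero_iff] at h
  obtain ⟨k, hk⟩ := h
  refine ⟨n, k, ?_⟩
  have : n * α - k = z := by
    rw [zsmul_eq_mul, mul_one] at hk
    linarith
  rwa [this]

/-- The times `n` and winding numbers `w` of the visits to an interval attain all pairs of residues
modulo `N`. -/
lemma Irrational.exists_nat_mul_sub_int_mem_Ioo_modEq {α : ℝ} (hα : Irrational α) {N : ℕ}
    (hN : 0 < N) (p q : ℤ) {a b : ℝ} (hab : a < b) :
    ∃ (n : ℕ) (w : ℤ), n * α - w ∈ Ioo a b ∧ (n : ℤ) ≡ p [ZMOD N] ∧ w ≡ q [ZMOD N] := by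
  have hN' : (0:ℝ) < N := by exact_mod_cast hN
  have hN₀ : (N:ℤ) ≠ 0 := by exact_mod_cast hN.ne'
  obtain ⟨r, hr⟩ := Int.eq_ofNat_of_zero_le (Int.emod_nonneg p hN₀)
  obtain ⟨n, w, h₁, h₂⟩ := hα.exists_nat_mul_sub_int_mem_Ioo
    (div_lt_div_of_pos_right (sub_lt_sub_right hab (r * α - q)) hN')
  refine ⟨r + N * n, q + N * w, ?_, ?_, ?_⟩
  · rw [div_lt_iff₀ hN'] at h₁
    rw [lt_div_iff₀ hN'] at h₂
    push_cast
    constructor <;> linarith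
  · push_cast
    rw [← hr]
    exact (Int.modEq_add_fac_self.trans (Int.mod_modEq p N))
  · exact Int.modEq_add_fac_self

lemma exists_mul_add_mul_modEq {N A B : ℤ}
    (h : ∀ k : ℤ, k ∣ N → k ∣ A → k ∣ B → IsUnit k) (c : ℤ) :
    ∃ p q : ℤ, p * A + q * B ≡ c [ZMOD N] := by
  have hu : IsUnit (gcd N (gcd A B)) :=
    h _ (gcd_dvd_left _ _) ((gcd_dvd_right _ _).trans (gcd_dvd_left _ _))
      ((gcd_dvd_right _ _).trans (gcd_dvd_right _ _))
  obtain ⟨v, hv⟩ := hu.dvd (a := c)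
  obtain ⟨x, y, hxy⟩ := exists_gcd_eq_mul_add_mul N (gcd A B)
  obtain ⟨x', y', hxy'⟩ := exists_gcd_eq_mul_add_mul A B
  refine ⟨x' * y * v, y' * y * v, (Int.modEq_iff_dvd.2 ⟨x * v, ?_⟩)⟩
  rw [hv, hxy, hxy']
  ring

lemma exists_int_abs_sub_lt_of_dist_lt {a b ε : ℝ}
    (h : dist (a : AddCircle (1:ℝ)) (b : AddCircle (1:ℝ)) < ε) : ∃ k : ℤ, |a - b - k| < ε := by
  rw [dist_eq_norm, ← AddCircle.coe_sub, UnitAddCircle.norm_eq] at h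
  exact ⟨_, h⟩

lemma dist_coe_le_abs_sub (a b : ℝ) :
    dist (a : AddCircle (1:ℝ)) (b : AddCircle (1:ℝ)) ≤ |a - b| := by
  rw [dist_eq_norm, ← AddCircle.coe_sub, UnitAddCircle.norm_eq]
  simpa using round_le (a - b) 0

/-- If `ζ₁ = mα - 1` with `m ≥ 2`, `0 < mα - 1 < 1` and `α < 1/(m-1)`, the extension `T_f` of the rotation by `α` is minimal iff `gcd(N, a₁ + (m-2)·a₂, m·a₂) = 1`. -/
theorem twoval_minimal_iff_of_eq_mul_alpha_sub_one
    (α : ℝ) (hα : α ∈ Ioo (0:ℝ) 1) (hirr : Irrational α) (N : ℕ) (hN : 2 ≤ N)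
    (m : ℤ) (hm : 2 ≤ m) (a₁ a₂ : ℤ) (ζ : ℝ) (hζ : ζ = (m : ℝ) * α - 1)
    (hζmem : ζ ∈ Ioo (0:ℝ) 1) (hαm : α < 1 / ((m : ℝ) - 1)) :
    MinimalExt (rot α) (twoval N ζ a₁ a₂) ↔
      ∀ k : ℤ, k ∣ (N : ℤ) → k ∣ a₁ + (m - 2) * a₂ → k ∣ m * a₂ → IsUnit k := by
  lift m to ℕ using by omega
  rw [Int.cast_natCast] at hζ
  have hgcd (k : ℤ) : (k ∣ a₁ + (m - 2) * a₂ ∧ k ∣ m * a₂) ↔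
      (k ∣ 2 * a₂ - a₁ ∧ k ∣ (a₁ - a₂) * m) := by
    constructor
    · rintro ⟨⟨u, hu⟩, v, hv⟩
      exact ⟨⟨v - u, by linear_combination hv - hu⟩,
        ⟨m * (u - v) + v, by linear_combination (m : ℤ) * hu + (1 - m) * hv⟩⟩
    · rintro ⟨⟨u, hu⟩, v, hv⟩
      exact ⟨⟨(m - 1) * u + v, by linear_combination (m - 1) * hu + hv⟩,
        ⟨m * u + v, by linear_combination (m : ℤ) * hu + hv⟩⟩
  constructor
  · intro hmin k hkN hk₁ hk₂
    obtain ⟨hk₃, hk₄⟩ := (hgcd k).1 ⟨hk₁, hk₂⟩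
    obtain ⟨δ, hδ, hconst⟩ := exists_stepSum_eq_right α m 0
    have hδ' : 0 < min δ 1 := lt_min hδ one_pos
    have hδ₁ := min_le_left δ 1
    have hδ₂ := min_le_right δ 1
    obtain ⟨n, hn, hns⟩ := hmin 0 (by simp) 0 (min δ 1 / 2) ⟨by linarith, by linarith⟩ 1
      (min δ 1 / 2) (by linarith)
    rw [skew_rot_twoval_iterate hζ hζmem N a₁ a₂ (by simp) 0 n] at hn hns
    obtain ⟨j, hj⟩ := exists_int_abs_sub_lt_of_dist_lt hn
    rw [abs_lt] at hj
    have hf := Int.self_sub_floor (0 + n * α)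
    have hstep : stepSum α m (0 + n * α) = stepSum α m 0 + m * (⌊0 + n * α⌋ + j) := by
      rw [← hconst (0 + n * α - ((⌊0 + n * α⌋ + j : ℤ) : ℝ)) (by push_cast; linarith)
        (by push_cast; linarith), ← stepSum_add_intCast]
      congr 1
      ring
    rw [hstep] at hns
    simp only [zero_add] at hns
    have hdvd : (N : ℤ) ∣ 1 - _ :=
      (ZMod.intCast_eq_intCast_iff_dvd_sub _ 1 N).1 (by rw [hns, Int.cast_one])
    refine isUnit_of_dvd_one ?_
    refine (dvd_sub_left ?_).1 (hkN.trans hdvd)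
    obtain ⟨u, hu⟩ := hk₃
    obtain ⟨v, hv⟩ := hk₄
    rw [hu]
    exact ⟨n * u + v * (⌊n * α⌋ + j), by linear_combination (⌊n * α⌋ + j) * hv⟩
  · intro hk x hx s y hy u ε hε
    obtain ⟨δ, hδ, hconst⟩ := exists_stepSum_eq_right α m y
    have hy₁ : y < min (min (y + δ) 1) (y + ε) :=
      lt_min (lt_min (by linarith) hy.2) (by linarith)
    obtain ⟨c, hc⟩ := ZMod.intCast_surjective
      (u - s - (((a₁ - a₂) * (stepSum α m y - stepSum α m x) : ℤ) : ZMod N))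
    obtain ⟨p, q, hpq⟩ := exists_mul_add_mul_modEq (N := N) (A := 2 * a₂ - a₁)
      (B := (a₁ - a₂) * m) (fun k h₁ h₂ h₃ =>
        hk k h₁ ((hgcd k).2 ⟨h₂, h₃⟩).1 ((hgcd k).2 ⟨h₂, h₃⟩).2) c
    obtain ⟨n, w, ⟨hl, hr⟩, hnp, hwq⟩ := hirr.exists_nat_mul_sub_int_mem_Ioo_modEq
      (by omega : 0 < N) p q (sub_lt_sub_right hy₁ x)
    rw [lt_sub_iff_add_lt, lt_min_iff, lt_min_iff] at hr
    obtain ⟨⟨hr₁, hr₂⟩, hr₃⟩ := hr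
    have hfract : Int.fract (x + n * α) = x + n * α - w := by
      rw [Int.fract_eq_iff]
      exact ⟨by linarith [hy.1], by linarith, w, by ring⟩
    have hstep : stepSum α m (x + n * α) = stepSum α m y + m * w := by
      rw [← hconst (x + n * α - w) (by linarith) (by linarith), ← stepSum_add_intCast,
        sub_add_cancel]
    refine ⟨n, ?_⟩
    rw [skew_rot_twoval_iterate hζ hζmem N a₁ a₂ hx s n, hfract, hstep]
    refine ⟨(dist_coe_le_abs_sub _ _).trans_lt ?_, ?_⟩
    · rw [abs_lt]
      constructor <;> linarith
    · have hmod := (ZMod.intCast_eq_intCast_iff _ _ N).2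
        (((hnp.mul_right (2 * a₂ - a₁)).add (hwq.mul_right ((a₁ - a₂) * m))).trans hpq)
      rw [hc] at hmod
      push_cast at hmod ⊢
      linear_combination hmod
end
end
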